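/- arXiv:1208.4955 — 3 statements merged into one kernel-verified Lean document; each statement's English description precedes it below -/
import Mathlib

section
/- There exists a constant C_E > 1 (one may take the constant of the curve lemma: every pair of points of ℝ² can be joined by a rectifiable curve of Euclidean length at most C_E times their distance meeting E in at most two points) such that for every δ in (0,1) and all x, y in ℝ²: |x − y| ≤ d_δ(x,y) ≤ C_E |x − y|. In particular, each d_δ is a distance on ℝ² bi-Lipschitz equivalent to the Euclidean distance with constants independent of δ. -/
open MeasureTheory Metric Filter Topology
open scoped NNReal ENNReal

noncomputable section

/-- The plane with the Euclidean distance. -/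
abbrev E2 := EuclideanSpace ℝ (Fin 2)

/-- Length of the level-`n` intervals of the Cantor construction: at each step the open
middle interval of length `(1/10)^(n+1)` is removed and two closed intervals of equal
length remain. -/
def clen : ℕ → ℝ
  | 0 => 1
  | n + 1 => (clen n - (1 / 10) ^ (n + 1)) / 2

/-- Left endpoint of the interval `I_w`; words are written with the innermost (deepest)
digit first, `false` = left child, `true` = right child. -/
def cleft : List Bool → ℝ
  | [] => 0
  | b :: w => cleft w + if b then clen w.length - clen (w.length + 1) else 0

/-- The interval `I_w` of the Cantor construction. -/
def cInt (w : List Bool) : Set ℝ := Set.Icc (cleft w) (cleft w + clen w.length)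

/-- The fat Cantor set `F`. -/
def cantorF : Set ℝ := ⋂ n : ℕ, ⋃ w ∈ {w : List Bool | w.length = n}, cInt w

/-- The planar Cantor set `E = F × F`. -/
def cantorE : Set E2 := {z | z 0 ∈ cantorF ∧ z 1 ∈ cantorF}

/-- The intrinsic distance `d_δ` of the perturbed Dirichlet form
`E_δ(u,u) = ∫ (1 − δ 1_E) |∇u|² dm`:  the supremum of `u(x) − u(y)` over all Lipschitz
`u : ℝ² → ℝ` whose a.e.-defined total derivative satisfies `‖Du‖ ≤ 1` a.e. off `E` and
`‖Du‖ ≤ (1 − δ)^{-1/2}` a.e. on `E`. -/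
def dDelta (δ : ℝ) (x y : E2) : ℝ :=
  sSup {r : ℝ | ∃ u : E2 → ℝ, (∃ L : ℝ≥0, LipschitzWith L u) ∧
    (∀ᵐ z ∂volume, (z ∉ cantorE → ‖fderiv ℝ u z‖ ≤ 1) ∧
      (z ∈ cantorE → ‖fderiv ℝ u z‖ ≤ 1 / Real.sqrt (1 - δ))) ∧
    r = u x - u y}

/-! ### Lipschitz functions with a.e. bounded derivative -/

/-- A Lipschitz function whose derivative is a.e. bounded by `1` on a convex open set does not
increase distances on that set. -/
theorem LipschitzWith.abs_sub_le_of_ae_norm_fderiv_le {V : Type*} [NormedAddCommGroup V]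
    [NormedSpace ℝ V] [FiniteDimensional ℝ V] [MeasurableSpace V] [BorelSpace V]
    {μ : Measure V} [μ.IsAddHaarMeasure] {u : V → ℝ} {L : ℝ≥0} (hu : LipschitzWith L u)
    {U : Set V} (hU : IsOpen U) (hconv : Convex ℝ U)
    (hbound : ∀ᵐ z ∂μ, z ∈ U → ‖fderiv ℝ u z‖ ≤ 1) {p q : V} (hp : p ∈ U) (hq : q ∈ U) :
    |u q - u p| ≤ ‖q - p‖ := by
  set v : V := q - p with hv
  let A : ℝ →L[ℝ] V := ContinuousLinearMap.smulRight (1 : ℝ →L[ℝ] ℝ) v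
  have hgood : ∀ᵐ z ∂μ, DifferentiableAt ℝ u z ∧ (z ∈ U → ‖fderiv ℝ u z‖ ≤ 1) :=
    hu.ae_differentiableAt.and hbound
  obtain ⟨G, hGsub, hGmeas, hGnull⟩ :=
    exists_measurable_superset_of_null (show μ {z | ¬ _} = 0 from hgood)
  have hline : ∀ᵐ y ∂μ, ∀ᵐ t : ℝ, y + A t ∈ Gᶜ :=
    (ae_ae_add_linearMap_mem_iff A.toLinearMap volume μ hGmeas.compl).2
      (by simpa [ae_iff] using hGnull)
  have hdense : Dense {y | ∀ᵐ t : ℝ, y + A t ∈ Gᶜ} := Measure.dense_of_ae hline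
  have hW : IsOpen {y | y ∈ U ∧ y + v ∈ U} :=
    hU.inter (hU.preimage (continuous_id.add continuous_const))
  have hclosed : IsClosed {y | |u (y + v) - u y| ≤ ‖v‖} := by
    have := hu.continuous
    exact isClosed_le (by fun_prop) continuous_const
  have hpW : p ∈ {y | y ∈ U ∧ y + v ∈ U} := ⟨hp, by simpa [hv] using hq⟩
  have key : closure ({y | y ∈ U ∧ y + v ∈ U} ∩ {y | ∀ᵐ t : ℝ, y + A t ∈ Gᶜ}) ⊆
      {y | |u (y + v) - u y| ≤ ‖v‖} := by
    refine hclosed.closure_subset_iff.2 ?_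
    rintro y ⟨⟨hy, hyv⟩, hyt⟩
    have hAlip : LipschitzWith ‖A‖₊ fun t : ℝ ↦ y + A t := by
      simpa using (LipschitzWith.const y).add A.lipschitz
    have hac : AbsolutelyContinuousOnInterval (fun t : ℝ ↦ u (y + A t)) 0 1 :=
      (hu.comp hAlip).lipschitzOnWith.absolutelyContinuousOnInterval
    have hint := hac.integral_deriv_eq_sub
    have hle : ‖∫ t in (0 : ℝ)..1, deriv (fun t : ℝ ↦ u (y + A t)) t‖ ≤ ‖v‖ * |1 - 0| := by
      refine intervalIntegral.norm_integral_le_of_norm_le_const_ae ?_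
      filter_upwards [hyt] with t ht htI
      rw [Set.uIoc_of_le zero_le_one] at htI
      have ht' : DifferentiableAt ℝ u (y + A t) ∧ (y + A t ∈ U → ‖fderiv ℝ u (y + A t)‖ ≤ 1) := by
        by_contra hcon
        exact ht (hGsub hcon)
      have hmem : y + A t ∈ U := by
        have := hconv hy hyv (sub_nonneg.2 htI.2) htI.1.le (by ring)
        convert this using 1
        simp only [A, ContinuousLinearMap.smulRight_apply, one_apply_eq_self]
        module
      have hder : HasDerivAt (fun t : ℝ ↦ y + A t) v t := by
        have := (A.hasDerivAt (x := t)).const_add y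
        simpa [A] using this
      have := (ht'.1.hasFDerivAt.comp_hasDerivAt t hder).deriv
      rw [show deriv (fun t : ℝ ↦ u (y + A t)) t = fderiv ℝ u (y + A t) v from this]
      calc ‖fderiv ℝ u (y + A t) v‖ ≤ ‖fderiv ℝ u (y + A t)‖ * ‖v‖ :=
            ContinuousLinearMap.le_opNorm _ _
        _ ≤ 1 * ‖v‖ := by gcongr; exact ht'.2 hmem
        _ = ‖v‖ := one_mul _
    rw [hint] at hle
    simpa [A] using hle
  have := key (hdense.open_subset_closure_inter hW hpW)
  simpa [hv] using this

/-! ### The Cantor set has empty interior -/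

theorem clen_eq (n : ℕ) : clen n = (1 / 2) ^ n * (7 / 8 + 1 / 8 * (1 / 5) ^ n) := by
  induction n with
  | zero => norm_num [clen]
  | succ n ih =>
    have : ((1 : ℝ) / 10) ^ n = (1 / 2) ^ n * (1 / 5) ^ n := by rw [← mul_pow]; norm_num
    rw [clen, ih, pow_succ, this]
    ring

theorem clen_pos (n : ℕ) : 0 < clen n := by
  rw [clen_eq]; positivity

theorem clen_le (n : ℕ) : clen n ≤ (1 / 2) ^ n := by
  rw [clen_eq]
  have : ((1 : ℝ) / 5) ^ n ≤ 1 := pow_le_one₀ (by norm_num) (by norm_num)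
  exact mul_le_of_le_one_right (by positivity) (by linarith)

theorem two_mul_clen_succ_lt (n : ℕ) : 2 * clen (n + 1) < clen n := by
  have : (0 : ℝ) < (1 / 10) ^ (n + 1) := by positivity
  rw [clen]; linarith

theorem cInt_cons_subset (b : Bool) (w : List Bool) : cInt (b :: w) ⊆ cInt w := by
  have h1 := two_mul_clen_succ_lt w.length
  have h2 := clen_pos (w.length + 1)
  rintro t ⟨h3, h4⟩
  cases b <;> simp only [cleft, List.length_cons, if_true, if_false, Bool.false_eq_true] at h3 h4 <;>
    constructor <;> linarith

theorem eq_of_mem_cInt {v w : List Bool} (hlen : v.length = w.length) {t : ℝ}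
    (hv : t ∈ cInt v) (hw : t ∈ cInt w) : v = w := by
  induction v generalizing w with
  | nil => exact (List.length_eq_zero_iff.1 hlen.symm).symm
  | cons b v ih =>
    cases w with
    | nil => simp at hlen
    | cons c w =>
      obtain rfl := ih (by simpa using hlen) (cInt_cons_subset b v hv) (cInt_cons_subset c w hw)
      have h1 := two_mul_clen_succ_lt v.length
      obtain ⟨h2, h3⟩ := hv
      obtain ⟨h4, h5⟩ := hw
      cases b <;> cases c <;>
        simp only [cleft, List.length_cons, if_true, if_false, Bool.false_eq_true] at h2 h3 h4 h5 <;>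
        first | rfl | linarith

/-- The midpoint of a construction interval is removed at the next step. -/
theorem midpoint_notMem_cantorF (w : List Bool) :
    cleft w + clen w.length / 2 ∉ cantorF := by
  intro h
  obtain ⟨v, hv, hmem⟩ := Set.mem_iUnion₂.1 (Set.mem_iInter.1 h (w.length + 1))
  have hpos := clen_pos w.length
  have hlt := two_mul_clen_succ_lt w.length
  cases v with
  | nil => simp at hv
  | cons b v =>
    have hlen : v.length = w.length := by simpa using hv
    obtain rfl : v = w := eq_of_mem_cInt hlen (cInt_cons_subset b v hmem)
      ⟨by linarith, by linarith⟩
    obtain ⟨h1, h2⟩ := hmem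
    cases b <;>
      simp only [cleft, List.length_cons, if_true, if_false, Bool.false_eq_true] at h1 h2 <;>
      linarith

theorem isClosed_cantorF : IsClosed cantorF :=
  isClosed_iInter fun n ↦
    (List.finite_length_eq Bool n).isClosed_biUnion fun _ _ ↦ isClosed_Icc

theorem dense_compl_cantorF : Dense cantorFᶜ := by
  rw [Metric.dense_iff]
  intro t ε hε
  by_cases ht : t ∈ cantorF
  · obtain ⟨n, hn⟩ := exists_pow_lt_of_lt_one hε (by norm_num : (1 / 2 : ℝ) < 1)
    obtain ⟨w, rfl, h1, h2⟩ := Set.mem_iUnion₂.1 (Set.mem_iInter.1 ht n)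
    have hpos := clen_pos w.length
    have hle := clen_le w.length
    refine ⟨_, ?_, midpoint_notMem_cantorF w⟩
    rw [Metric.mem_ball, Real.dist_eq, abs_lt]
    constructor <;> linarith
  · exact ⟨t, Metric.mem_ball_self hε, ht⟩

theorem exists_notMem_cantorF (t : ℝ) {r : ℝ} (hr : 0 < r) : ∃ s ∉ cantorF, |s - t| ≤ r := by
  obtain ⟨s, hs, hs'⟩ := Metric.dense_iff.1 dense_compl_cantorF t r hr
  exact ⟨s, hs', by simpa [Real.dist_eq] using (Metric.mem_ball.1 hs).le⟩

/-! ### Norms in the plane -/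

theorem E2.abs_apply_le_norm (z : E2) (i : Fin 2) : |z i| ≤ ‖z‖ := by
  simpa using PiLp.norm_apply_le z i

theorem E2.norm_le_abs_add_abs (z : E2) : ‖z‖ ≤ |z 0| + |z 1| := by
  rw [EuclideanSpace.norm_eq, Fin.sum_univ_two]
  refine Real.sqrt_le_iff.2 ⟨by positivity, ?_⟩
  simp only [Real.norm_eq_abs]
  nlinarith [abs_nonneg (z 0), abs_nonneg (z 1)]

/-! ### Infinite polygonal curves -/

/-- The piecewise affine function equal to `0` up to `2⁻⁽ⁿ⁺¹⁾` and to `1` from `2⁻ⁿ` on. -/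
def dyadicRamp (n : ℕ) (t : ℝ) : ℝ := max 0 (min 1 (2 ^ (n + 1) * t - 1))

theorem dyadicRamp_nonneg (n : ℕ) (t : ℝ) : 0 ≤ dyadicRamp n t := le_max_left _ _

theorem dyadicRamp_le_one (n : ℕ) (t : ℝ) : dyadicRamp n t ≤ 1 :=
  max_le zero_le_one (min_le_left _ _)

theorem dyadicRamp_eq_zero {n : ℕ} {t : ℝ} (h : t ≤ (1 / 2) ^ (n + 1)) : dyadicRamp n t = 0 := by
  refine max_eq_left ((min_le_right _ _).trans ?_)
  have : (2 : ℝ) ^ (n + 1) * t ≤ 2 ^ (n + 1) * (1 / 2) ^ (n + 1) := by gcongr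
  rw [← mul_pow] at this
  norm_num at this
  linarith

theorem dyadicRamp_eq_one {n : ℕ} {t : ℝ} (h : (1 / 2) ^ n ≤ t) : dyadicRamp n t = 1 := by
  have : (2 : ℝ) ^ (n + 1) * (1 / 2) ^ n ≤ 2 ^ (n + 1) * t := by gcongr
  rw [pow_succ, mul_right_comm, ← mul_pow] at this
  norm_num at this
  rw [dyadicRamp, pow_succ, min_eq_left (by linarith), max_eq_right zero_le_one]

theorem abs_dyadicRamp_sub_le (n : ℕ) (s t : ℝ) :
    |dyadicRamp n s - dyadicRamp n t| ≤ 2 ^ (n + 1) * |s - t| := by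
  calc |dyadicRamp n s - dyadicRamp n t|
      ≤ |(2 ^ (n + 1) * s - 1) - (2 ^ (n + 1) * t - 1)| := by
        unfold dyadicRamp
        rw [max_comm 0, max_comm 0, min_comm 1, min_comm 1]
        exact (abs_max_sub_max_le_abs _ _ _).trans (abs_inf_sub_inf_le_abs _ _ _)
    _ = 2 ^ (n + 1) * |s - t| := by
        rw [show ((2 : ℝ) ^ (n + 1) * s - 1) - (2 ^ (n + 1) * t - 1) = 2 ^ (n + 1) * (s - t) by ring,
          abs_mul, abs_of_pos (by positivity)]

/-- Points converging geometrically to `x` are the vertices of a Lipschitz polygonal curve with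
endpoint `x`. -/
theorem exists_lipschitz_polygonal {V : Type*} [NormedAddCommGroup V] [NormedSpace ℝ V]
    [CompleteSpace V] {p : ℕ → V} {x : V} {c : ℝ} (hp : ∀ n, ‖p n - x‖ ≤ c * (1 / 4) ^ n) :
    ∃ γ : ℝ → V, LipschitzWith (8 * c).toNNReal γ ∧ γ 0 = x ∧ γ 1 = p 0 ∧
      ∀ t ∈ Set.Ioc (0 : ℝ) 1, ∃ n, γ t ∈ segment ℝ (p (n + 1)) (p n) := by
  have hc : 0 ≤ c := by simpa using (norm_nonneg _).trans (hp 0)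
  have hw : ∀ n, ‖p n - p (n + 1)‖ ≤ 2 * c * (1 / 4) ^ n := fun n ↦ by
    calc ‖p n - p (n + 1)‖ ≤ ‖p n - x‖ + ‖p (n + 1) - x‖ := by
          simpa using norm_sub_le (p n - x) (p (n + 1) - x)
      _ ≤ c * (1 / 4) ^ n + c * (1 / 4) ^ (n + 1) := add_le_add (hp n) (hp (n + 1))
      _ ≤ 2 * c * (1 / 4) ^ n := by
          have : 0 ≤ c * (1 / 4 : ℝ) ^ n := by positivity
          rw [pow_succ]; linarith
  have hgeom : Summable fun n : ℕ ↦ 2 * c * (1 / 4 : ℝ) ^ n :=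
    (summable_geometric_of_lt_one (by norm_num) (by norm_num)).mul_left _
  have hsw : Summable fun n ↦ p n - p (n + 1) := .of_norm_bounded hgeom hw
  have hs : ∀ t, Summable fun n ↦ dyadicRamp n t • (p n - p (n + 1)) := fun t ↦ by
    refine .of_norm_bounded hgeom fun n ↦ ?_
    rw [norm_smul, Real.norm_of_nonneg (dyadicRamp_nonneg n t)]
    exact (mul_le_of_le_one_left (norm_nonneg _) (dyadicRamp_le_one n t)).trans (hw n)
  have hlim : Tendsto p atTop (𝓝 x) := by
    rw [tendsto_iff_norm_sub_tendsto_zero]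
    refine squeeze_zero (fun _ ↦ norm_nonneg _) hp ?_
    simpa using (tendsto_pow_atTop_nhds_zero_of_lt_one (r := (1 / 4 : ℝ))
      (by norm_num) (by norm_num)).const_mul c
  have htel : ∀ k, ∑' n, (p (n + k) - p (n + k + 1)) = p k - x := fun k ↦ by
    have h1 := ((summable_nat_add_iff k).2 hsw).hasSum.tendsto_sum_nat
    refine tendsto_nhds_unique h1 ?_
    have h2 : ∀ m, ∑ n ∈ Finset.range m, (p (n + k) - p (n + k + 1)) = p k - p (m + k) :=
      fun m ↦ by
        have := Finset.sum_range_sub' (fun n ↦ p (n + k)) m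
        simpa [add_right_comm] using this
    simp only [h2]
    exact tendsto_const_nhds.sub (hlim.comp (tendsto_add_atTop_nat k))
  refine ⟨fun t ↦ x + ∑' n, dyadicRamp n t • (p n - p (n + 1)), ?_, ?_, ?_, ?_⟩
  · refine LipschitzWith.of_dist_le_mul fun s t ↦ ?_
    rw [Real.coe_toNNReal _ (by positivity), dist_add_left, dist_eq_norm,
      ← (hs s).tsum_sub (hs t), Real.dist_eq]
    have hsum : HasSum (fun n : ℕ ↦ 4 * c * |s - t| * (1 / 2 : ℝ) ^ n) (4 * c * |s - t| * 2) :=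
      hasSum_geometric_two.mul_left _
    refine (tsum_of_norm_bounded hsum fun n ↦ ?_).trans (by linarith)
    rw [← sub_smul, norm_smul, Real.norm_eq_abs]
    calc |dyadicRamp n s - dyadicRamp n t| * ‖p n - p (n + 1)‖
        ≤ (2 ^ (n + 1) * |s - t|) * (2 * c * (1 / 4) ^ n) := by
          gcongr
          exacts [abs_dyadicRamp_sub_le n s t, hw n]
      _ = 4 * c * |s - t| * (2 ^ n * (1 / 4) ^ n) := by ring
      _ = 4 * c * |s - t| * (1 / 2) ^ n := by rw [← mul_pow]; norm_num
  · have : ∀ n, dyadicRamp n 0 = 0 := fun n ↦ dyadicRamp_eq_zero (by positivity)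
    simp [this]
  · have : ∀ n, dyadicRamp n 1 = 1 := fun n ↦
      dyadicRamp_eq_one (pow_le_one₀ (by norm_num) (by norm_num))
    have h0 := htel 0
    simp only [add_zero] at h0
    simp [this, h0]
  · rintro t ⟨ht0, ht1⟩
    obtain ⟨N, hN1, hN2⟩ := exists_nat_pow_near_of_lt_one ht0 ht1
      (by norm_num : (0 : ℝ) < 1 / 2) (by norm_num)
    refine ⟨N, ?_⟩
    have hanti : Antitone fun n : ℕ ↦ (1 / 2 : ℝ) ^ n :=
      pow_right_anti₀ (by norm_num) (by norm_num)
    have hhead : ∑ n ∈ Finset.range (N + 1), dyadicRamp n t • (p n - p (n + 1)) =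
        dyadicRamp N t • (p N - p (N + 1)) := by
      rw [Finset.sum_range_succ, Finset.sum_eq_zero, zero_add]
      intro n hn
      rw [dyadicRamp_eq_zero (hN2.trans (hanti (Finset.mem_range.1 hn))), zero_smul]
    have htail : ∑' n, dyadicRamp (n + (N + 1)) t • (p (n + (N + 1)) - p (n + (N + 1) + 1)) =
        p (N + 1) - x := by
      rw [← htel (N + 1)]
      refine tsum_congr fun n ↦ ?_
      rw [dyadicRamp_eq_one ((hanti (by omega)).trans hN1.le), one_smul]
    beta_reduce
    rw [← (hs t).sum_add_tsum_nat_add (N + 1), hhead, htail]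
    refine ⟨1 - dyadicRamp N t, dyadicRamp N t, sub_nonneg.2 (dyadicRamp_le_one N t),
      dyadicRamp_nonneg N t, by ring, ?_⟩
    module

/-! ### Curves almost avoiding `E` -/

/-- A Lipschitz curve from `x` to a point with both coordinates outside `F` which avoids `E`
except possibly at `x`. -/
theorem exists_curve_avoiding_cantorE {x z : E2} {r : ℝ} (hr : 0 < r)
    (hz : ∀ i, z i ∉ cantorF) (hxz : ∀ i, |z i - x i| ≤ r) :
    ∃ γ : ℝ → E2, LipschitzWith (64 * r).toNNReal γ ∧ γ 0 = x ∧ γ 1 = z ∧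
      ∀ t ∈ Set.Ioc (0 : ℝ) 1, γ t ∉ cantorE := by
  have hex : ∀ i : Fin 2, ∃ g : ℕ → ℝ, g 0 = z i ∧ ∀ k, g k ∉ cantorF ∧
      |g k - x i| ≤ r * (1 / 16) ^ k := fun i ↦ by
    choose s hs hs' using fun k : ℕ ↦
      exists_notMem_cantorF (x i) (r := r * (1 / 16) ^ k) (by positivity)
    refine ⟨fun k ↦ if k = 0 then z i else s k, by simp, fun k ↦ ?_⟩
    rcases eq_or_ne k 0 with rfl | hk
    · simpa using ⟨hz i, hxz i⟩
    · simpa [hk] using ⟨hs k, by simpa using hs' k⟩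
  obtain ⟨g, hg0, hg⟩ := hex 0
  obtain ⟨h, hh0, hh⟩ := hex 1
  let p : ℕ → E2 := fun n ↦ !₂[g ((n + 1) / 2), h (n / 2)]
  have hp : ∀ n, ‖p n - x‖ ≤ 8 * r * (1 / 4) ^ n := fun n ↦ by
    refine (E2.norm_le_abs_add_abs _).trans ?_
    have hsq : ∀ k : ℕ, (1 / 4 : ℝ) ^ (2 * k) = (1 / 16) ^ k := fun k ↦ by
      rw [pow_mul]; norm_num
    obtain ⟨k, rfl | rfl⟩ := Nat.even_or_odd' n
    · have h1 := (hg k).2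
      have h2 := (hh k).2
      have : 0 ≤ r * (1 / 16 : ℝ) ^ k := by positivity
      simp only [p, PiLp.sub_apply, Matrix.cons_val_zero, Matrix.cons_val_one,
        show (2 * k + 1) / 2 = k by omega, show 2 * k / 2 = k by omega, hsq]
      linarith
    · have h1 := (hg (k + 1)).2
      have h2 := (hh k).2
      have : 0 ≤ r * (1 / 16 : ℝ) ^ k := by positivity
      simp only [p, PiLp.sub_apply, Matrix.cons_val_zero, Matrix.cons_val_one,
        show (2 * k + 1 + 1) / 2 = k + 1 by omega, show (2 * k + 1) / 2 = k by omega,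
        pow_succ, hsq]
      rw [pow_succ] at h1
      linarith
  obtain ⟨γ, hγ, hγ0, hγ1, hseg⟩ := exists_lipschitz_polygonal hp
  refine ⟨γ, ?_, hγ0, ?_, fun t ht hE ↦ ?_⟩
  · rwa [show 64 * r = 8 * (8 * r) by ring]
  · rw [hγ1]
    ext i
    fin_cases i <;> simp [p, hg0, hh0]
  · obtain ⟨n, a, b, -, -, hab, hγt⟩ := hseg t ht
    rw [← hγt] at hE
    obtain ⟨k, rfl | rfl⟩ := Nat.even_or_odd' n
    · have h1 := hE.2
      simp only [p, PiLp.add_apply, PiLp.smul_apply, Matrix.cons_val_one,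
        Matrix.cons_val_zero, smul_eq_mul, show (2 * k + 1) / 2 = k by omega,
        show 2 * k / 2 = k by omega, ← add_mul, hab, one_mul] at h1
      exact (hh k).1 h1
    · have h1 := hE.1
      simp only [p, PiLp.add_apply, PiLp.smul_apply,
        Matrix.cons_val_zero, smul_eq_mul, show (2 * k + 1 + 1) / 2 = k + 1 by omega,
        show (2 * k + 1 + 1 + 1) / 2 = k + 1 by omega, ← add_mul, hab, one_mul] at h1
      exact (hg (k + 1)).1 h1

theorem exists_near_notMem_cantorF (x : E2) {r : ℝ} (hr : 0 < r) :
    ∃ z : E2, (∀ i, z i ∉ cantorF) ∧ ∀ i, |z i - x i| ≤ r := by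
  choose s hs hs' using fun i : Fin 2 ↦ exists_notMem_cantorF (x i) hr
  exact ⟨WithLp.toLp 2 s, hs, hs'⟩

/-- The curve lemma for `E`. -/
theorem exists_rectifiable_curve (x y : E2) :
    ∃ γ : ℝ → E2, ContinuousOn γ (Set.Icc 0 1) ∧ γ 0 = x ∧ γ 1 = y ∧
      eVariationOn γ (Set.Icc 0 1) ≤ ENNReal.ofReal (384 * dist x y) ∧
      ∃ a b : E2, (γ '' Set.Icc 0 1) ∩ cantorE ⊆ {a, b} := by
  rcases eq_or_ne x y with rfl | hxy
  · refine ⟨fun _ ↦ x, continuousOn_const, rfl, rfl, ?_, x, x, ?_⟩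
    · rw [eVariationOn.constant_on]
      · exact zero_le
      · exact (Set.subsingleton_singleton (a := x)).anti (by rintro _ ⟨_, _, rfl⟩; rfl)
    · rintro _ ⟨⟨_, _, rfl⟩, _⟩
      simp
  set r := dist x y with hr
  have hr0 : 0 < r := dist_pos.2 hxy
  obtain ⟨z, hz, hzx⟩ := exists_near_notMem_cantorF x hr0
  have hzy : ∀ i, |z i - y i| ≤ 2 * r := fun i ↦ by
    have h1 : |x i - y i| ≤ r := by
      rw [hr, dist_eq_norm]; exact E2.abs_apply_le_norm (x - y) i
    have := abs_sub_le (z i) (x i) (y i)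
    linarith [hzx i]
  obtain ⟨α, hα, hα0, hα1, hαE⟩ := exists_curve_avoiding_cantorE hr0 hz hzx
  obtain ⟨β, hβ, hβ0, hβ1, hβE⟩ := exists_curve_avoiding_cantorE (by positivity) hz hzy
  let γ : ℝ → E2 := fun t ↦ α (min 1 (2 * t)) + (β (min 1 (2 - 2 * t)) - z)
  have hleft : ∀ t ≤ (1 / 2 : ℝ), γ t = α (2 * t) := fun t ht ↦ by
    simp only [γ]
    rw [min_eq_right (by linarith), min_eq_left (by linarith), hβ1, sub_self, add_zero]
  have hright : ∀ t, (1 / 2 : ℝ) ≤ t → γ t = β (2 - 2 * t) := fun t ht ↦ by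
    simp only [γ]
    rw [min_eq_left (by linarith), min_eq_right (by linarith), hα1, add_sub_cancel]
  have hγ : LipschitzWith (384 * r).toNNReal γ := by
    refine LipschitzWith.of_dist_le_mul fun s t ↦ ?_
    have h1 := hα.dist_le_mul (min 1 (2 * s)) (min 1 (2 * t))
    have h2 := hβ.dist_le_mul (min 1 (2 - 2 * s)) (min 1 (2 - 2 * t))
    rw [Real.coe_toNNReal _ (by positivity), Real.dist_eq] at h1 h2
    have h3 : |min 1 (2 * s) - min 1 (2 * t)| ≤ 2 * |s - t| := by
      rw [min_comm 1, min_comm 1]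
      refine (abs_inf_sub_inf_le_abs _ _ _).trans_eq ?_
      rw [← mul_sub, abs_mul, abs_two]
    have h4 : |min 1 (2 - 2 * s) - min 1 (2 - 2 * t)| ≤ 2 * |s - t| := by
      rw [min_comm 1, min_comm 1]
      refine (abs_inf_sub_inf_le_abs _ _ _).trans_eq ?_
      rw [sub_sub_sub_cancel_left, ← mul_sub, abs_mul, abs_two, abs_sub_comm]
    rw [Real.coe_toNNReal _ (by positivity), Real.dist_eq]
    have h5 := dist_add_add_le (α (min 1 (2 * s))) (β (min 1 (2 - 2 * s)) - z)
      (α (min 1 (2 * t))) (β (min 1 (2 - 2 * t)) - z)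
    rw [dist_sub_right] at h5
    nlinarith
  refine ⟨γ, hγ.continuous.continuousOn, ?_, ?_, ?_, x, y, ?_⟩
  · rw [hleft 0 (by norm_num), mul_zero, hα0]
  · rw [hright 1 (by norm_num), ← hβ0]; norm_num
  · have h1 := (hγ.lipschitzOnWith (s := Set.univ)).comp_eVariationOn_le (g := (id : ℝ → ℝ))
      (s := Set.Icc 0 1) (Set.mapsTo_univ _ _)
    have h2 : eVariationOn (id : ℝ → ℝ) (Set.Icc 0 1) ≤ 1 := by simp
    calc eVariationOn γ (Set.Icc 0 1) ≤ ENNReal.ofReal (384 * r) * eVariationOn id (Set.Icc 0 1) :=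
          h1
      _ ≤ ENNReal.ofReal (384 * r) * 1 := by gcongr
      _ = _ := mul_one _
  · rintro _ ⟨⟨t, ⟨ht0, ht1⟩, rfl⟩, hE⟩
    rcases le_total t (1 / 2) with ht | ht
    · rw [hleft t ht] at hE ⊢
      rcases ht0.eq_or_lt with rfl | ht0
      · simp [hα0]
      · exact absurd hE (hαE _ ⟨by linarith, by linarith⟩)
    · rw [hright t ht] at hE ⊢
      rcases ht1.eq_or_lt with rfl | ht1
      · simp [hβ0]
      · exact absurd hE (hβE _ ⟨by linarith, by linarith⟩)

/-! ### The intrinsic distance -/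

/-- A Lipschitz function whose derivative is a.e. bounded by `1` off `E` is `1`-Lipschitz on
lines `z i = g`, `g ∉ F`. -/
theorem abs_sub_le_of_apply_eq {u : E2 → ℝ} {L : ℝ≥0} (hu : LipschitzWith L u)
    (hbound : ∀ᵐ z ∂(volume : Measure E2), z ∉ cantorE → ‖fderiv ℝ u z‖ ≤ 1) {i : Fin 2}
    {p q : E2} (hp : p i ∉ cantorF) (hpq : q i = p i) : |u q - u p| ≤ ‖q - p‖ := by
  obtain ⟨ε, hε, hball⟩ := Metric.isOpen_iff.1 isClosed_cantorF.isOpen_compl _ hp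
  have hU : IsOpen {z : E2 | z i ∈ Metric.ball (p i) ε} :=
    Metric.isOpen_ball.preimage (EuclideanSpace.proj i).continuous
  have hconv : Convex ℝ {z : E2 | z i ∈ Metric.ball (p i) ε} :=
    (convex_ball (p i) ε).is_linear_preimage
      (EuclideanSpace.proj (𝕜 := ℝ) i).toLinearMap.isLinear
  refine hu.abs_sub_le_of_ae_norm_fderiv_le (μ := volume) hU hconv ?_
    (Metric.mem_ball_self hε) (by simpa [hpq] using hε)
  filter_upwards [hbound] with z hz hzU
  refine hz fun hE ↦ hball hzU ?_
  fin_cases i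
  exacts [hE.1, hE.2]

theorem abs_sub_le_two_mul_dist {u : E2 → ℝ} {L : ℝ≥0} (hu : LipschitzWith L u)
    (hbound : ∀ᵐ z ∂(volume : Measure E2), z ∉ cantorE → ‖fderiv ℝ u z‖ ≤ 1) (x y : E2) :
    |u x - u y| ≤ 2 * dist x y := by
  let D : Set E2 := {z | ∀ i, z i ∉ cantorF}
  have hD : Dense D := Metric.dense_iff.2 fun x r hr ↦ by
    obtain ⟨z, hz, hzx⟩ := exists_near_notMem_cantorF x (r := r / 3) (by positivity)
    refine ⟨z, ?_, hz⟩
    rw [Metric.mem_ball, dist_eq_norm]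
    have := E2.norm_le_abs_add_abs (z - x)
    simp only [PiLp.sub_apply] at this
    linarith [hzx 0, hzx 1]
  have hclosed : IsClosed {w : E2 × E2 | |u w.1 - u w.2| ≤ 2 * dist w.1 w.2} := by
    have := hu.continuous
    exact isClosed_le (by fun_prop) (by fun_prop)
  have hsub : D ×ˢ D ⊆ {w : E2 × E2 | |u w.1 - u w.2| ≤ 2 * dist w.1 w.2} := by
    rintro ⟨a, b⟩ ⟨ha, hb⟩
    let m : E2 := !₂[b 0, a 1]
    have h1 : |u a - u m| ≤ ‖a - m‖ :=
      abs_sub_le_of_apply_eq hu hbound (i := 1) (by simpa [m] using ha 1) (by simp [m])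
    have h2 : |u m - u b| ≤ ‖m - b‖ :=
      abs_sub_le_of_apply_eq hu hbound (i := 0) (hb 0) (by simp [m])
    have h3 : ‖a - m‖ ≤ dist a b := by
      have := E2.norm_le_abs_add_abs (a - m)
      have h0 := E2.abs_apply_le_norm (a - b) 0
      simp [m] at this h0
      rw [dist_eq_norm]; linarith
    have h4 : ‖m - b‖ ≤ dist a b := by
      have := E2.norm_le_abs_add_abs (m - b)
      have h0 := E2.abs_apply_le_norm (a - b) 1
      simp [m] at this h0
      rw [dist_eq_norm]; linarith
    have := abs_sub_le (u a) (u m) (u b)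
    show |u a - u b| ≤ 2 * dist a b
    linarith
  have := (hclosed.closure_subset_iff.2 hsub) ((hD.prod hD) (x, y))
  exact this

/-- there is a constant `C_E > 1` (the constant of the curve lemma for `E`)
such that for every `δ ∈ (0,1)` and all `x, y ∈ ℝ²`,
`|x − y| ≤ d_δ(x,y) ≤ C_E |x − y|`; in particular each `d_δ` is bi-Lipschitz equivalent to
the Euclidean distance with constants independent of `δ`. -/
theorem stmt6 :
    ∃ C_E : ℝ, 1 < C_E ∧
      (∀ x y : E2,
        ∃ γ : ℝ → E2, ContinuousOn γ (Set.Icc 0 1) ∧ γ 0 = x ∧ γ 1 = y ∧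
          eVariationOn γ (Set.Icc 0 1) ≤ ENNReal.ofReal (C_E * dist x y) ∧
          ∃ a b : E2, (γ '' Set.Icc 0 1) ∩ cantorE ⊆ {a, b}) ∧
      ∀ δ ∈ Set.Ioo (0 : ℝ) 1, ∀ x y : E2,
        dist x y ≤ dDelta δ x y ∧ dDelta δ x y ≤ C_E * dist x y := by
  refine ⟨384, by norm_num, exists_rectifiable_curve, fun δ hδ x y ↦ ?_⟩
  have hmem : dist x y ∈ {r : ℝ | ∃ u : E2 → ℝ, (∃ L : ℝ≥0, LipschitzWith L u) ∧
      (∀ᵐ z ∂volume, (z ∉ cantorE → ‖fderiv ℝ u z‖ ≤ 1) ∧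
        (z ∈ cantorE → ‖fderiv ℝ u z‖ ≤ 1 / Real.sqrt (1 - δ))) ∧
      r = u x - u y} := by
    have hlip : LipschitzWith 1 fun z : E2 ↦ dist z y := LipschitzWith.dist_left y
    have h1 : ∀ z, ‖fderiv ℝ (fun z : E2 ↦ dist z y) z‖ ≤ 1 := fun z ↦ by
      simpa using norm_fderiv_le_of_lipschitz ℝ hlip (x₀ := z)
    have h2 : 1 ≤ 1 / Real.sqrt (1 - δ) := by
      rw [le_div_iff₀ (Real.sqrt_pos.2 (by linarith [hδ.2])), one_mul]
      exact Real.sqrt_le_iff.2 ⟨zero_le_one, by linarith [hδ.1]⟩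
    exact ⟨fun z ↦ dist z y, ⟨1, hlip⟩, .of_forall fun z ↦ ⟨fun _ ↦ h1 z, fun _ ↦ (h1 z).trans h2⟩,
      by simp⟩
  have hub : ∀ r ∈ {r : ℝ | ∃ u : E2 → ℝ, (∃ L : ℝ≥0, LipschitzWith L u) ∧
      (∀ᵐ z ∂volume, (z ∉ cantorE → ‖fderiv ℝ u z‖ ≤ 1) ∧
        (z ∈ cantorE → ‖fderiv ℝ u z‖ ≤ 1 / Real.sqrt (1 - δ))) ∧
      r = u x - u y}, r ≤ 384 * dist x y := by
    rintro _ ⟨u, ⟨L, hu⟩, hb, rfl⟩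
    have := abs_sub_le_two_mul_dist hu (hb.mono fun _ h ↦ h.1) x y
    linarith [le_abs_self (u x - u y), dist_nonneg (x := x) (y := y)]
  exact ⟨le_csSup ⟨_, hub⟩ hmem, csSup_le ⟨_, hmem⟩ hub⟩

end
end

section
/- Let V be a k-dimensional real vector space and let ‖·‖ and ‖·‖_o be two norms on V satisfying M^{−1}‖v‖ ≤ ‖v‖_o ≤ M‖v‖ for all v in V, where M ≥ 1. Then there exists a constant C(M,k) ≥ 1, depending only on M and k, such that C(M,k)^{−1} |||v||| ≤ |||v|||_o ≤ C(M,k) |||v||| for all v in V, where |||·||| and |||·|||_o are the Cheeger inner-product norms associated with ‖·‖ and ‖·‖_o respectively. -/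
open MeasureTheory Metric Filter Topology
open scoped NNReal ENNReal

noncomputable section

/-- The Lebesgue volume of the Euclidean unit ball of `ℝⁿ`. -/
def eucBallVol (n : ℕ) : ℝ :=
  (volume (ball (0 : EuclideanSpace ℝ (Fin n)) 1)).toReal

/-- Cheeger's averaged dual norm on the dual of a finite-dimensional normed space `W`:
`|||f|||* = ((k+1) (Vol k / Vol (k+2)) ∫_{B(0,1)} |f v|² dH^k)^{1/2}`,
where `H^k` is the `k`-dimensional Hausdorff measure of the metric induced by the norm,
`k = dim W`. -/
def cheegerDual (W : Type*) [NormedAddCommGroup W] [NormedSpace ℝ W]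
    [MeasurableSpace W] [BorelSpace W] (f : W →ₗ[ℝ] ℝ) : ℝ :=
  Real.sqrt (((Module.finrank ℝ W : ℝ) + 1) *
    (eucBallVol (Module.finrank ℝ W) / eucBallVol (Module.finrank ℝ W + 2)) *
    (∫⁻ v in ball (0 : W) 1, ENNReal.ofReal ((f v) ^ 2)
      ∂(Measure.hausdorffMeasure (Module.finrank ℝ W : ℝ))).toReal)

/-- Cheeger's inner-product norm associated with the norm of `W`:
`|||v||| = sup { f v : |||f|||* ≤ 1 }`. -/
def cheegerNorm (W : Type*) [NormedAddCommGroup W] [NormedSpace ℝ W]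
    [MeasurableSpace W] [BorelSpace W] (v : W) : ℝ :=
  sSup {r : ℝ | ∃ f : W →ₗ[ℝ] ℝ, cheegerDual W f ≤ 1 ∧ r = f v}

/-- A linear equivalence distorting norms by a factor at most `M` distorts the integral of the
square of a linear form over the unit ball by at most `M ^ (2 (k + 1))`. -/
theorem lintegral_ball_sq_le {V W : Type*} [NormedAddCommGroup V] [NormedSpace ℝ V]
    [MeasurableSpace V] [BorelSpace V] [NormedAddCommGroup W] [NormedSpace ℝ W]
    [MeasurableSpace W] [BorelSpace W] [FiniteDimensional ℝ W] {M : ℝ} (hM : 1 ≤ M) (k : ℕ)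
    (e : V ≃ₗ[ℝ] W) (he : ∀ v : V, M⁻¹ * ‖v‖ ≤ ‖e v‖ ∧ ‖e v‖ ≤ M * ‖v‖) (g : W →ₗ[ℝ] ℝ) :
    ∫⁻ w in ball (0 : W) 1, ENNReal.ofReal ((g w) ^ 2) ∂(Measure.hausdorffMeasure (k : ℝ)) ≤
      ENNReal.ofReal ((M ^ (k + 1)) ^ 2) *
        ∫⁻ v in ball (0 : V) 1, ENNReal.ofReal ((g (e v)) ^ 2)
          ∂(Measure.hausdorffMeasure (k : ℝ)) := by
  have hM0 : 0 < M := by positivity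
  set φ : V → W := fun v => M • e v with hφ
  have hlip : LipschitzWith (M ^ 2).toNNReal φ := by
    refine LipschitzWith.of_dist_le_mul fun x y => ?_
    rw [Real.coe_toNNReal _ (by positivity), dist_eq_norm, dist_eq_norm, hφ, ← smul_sub,
      ← map_sub, norm_smul, Real.norm_of_nonneg hM0.le, sq, mul_assoc]
    exact mul_le_mul_of_nonneg_left (he _).2 hM0.le
  have hsurj : Function.Surjective φ := fun w =>
    ⟨e.symm (M⁻¹ • w), by simp [hφ, smul_smul, hM0.ne']⟩
  have hmeas : Measurable φ := hlip.continuous.measurable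
  have hg : Measurable g := g.continuous_of_finiteDimensional.measurable
  have hle : (Measure.hausdorffMeasure (k : ℝ) : Measure W) ≤
      ENNReal.ofReal ((M ^ 2) ^ k) • (Measure.hausdorffMeasure (k : ℝ) : Measure V).map φ := by
    refine Measure.le_iff.2 fun s hs => ?_
    rw [Measure.smul_apply, Measure.map_apply hmeas hs, smul_eq_mul]
    calc (Measure.hausdorffMeasure (k : ℝ) : Measure W) s
        = Measure.hausdorffMeasure (k : ℝ) (φ '' (φ ⁻¹' s)) := by
          rw [Set.image_preimage_eq _ hsurj]
      _ ≤ _ := hlip.hausdorffMeasure_image_le k.cast_nonneg _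
      _ = _ := by
          rw [ENNReal.rpow_natCast, ENNReal.ofReal_pow (by positivity)]
          rfl
  have hsub : φ ⁻¹' ball (0 : W) 1 ⊆ ball (0 : V) 1 := by
    intro v hv
    simp only [hφ, Set.mem_preimage, mem_ball_zero_iff, norm_smul,
      Real.norm_of_nonneg hM0.le] at hv ⊢
    refine lt_of_le_of_lt ?_ hv
    have := mul_le_mul_of_nonneg_left (he v).1 hM0.le
    rwa [mul_inv_cancel_left₀ hM0.ne'] at this
  calc _ ≤ ∫⁻ w in ball (0 : W) 1, ENNReal.ofReal ((g w) ^ 2)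
        ∂(ENNReal.ofReal ((M ^ 2) ^ k) •
          (Measure.hausdorffMeasure (k : ℝ) : Measure V).map φ) :=
        lintegral_mono' (Measure.restrict_mono_measure hle _) le_rfl
    _ = ENNReal.ofReal ((M ^ 2) ^ k) * ∫⁻ v in φ ⁻¹' ball (0 : W) 1,
        ENNReal.ofReal ((g (φ v)) ^ 2) ∂(Measure.hausdorffMeasure (k : ℝ)) := by
        rw [Measure.restrict_smul, lintegral_smul_measure, smul_eq_mul,
          setLIntegral_map measurableSet_ball (hg.pow_const 2).ennreal_ofReal hmeas]
    _ ≤ ENNReal.ofReal ((M ^ 2) ^ k) * ∫⁻ v in ball (0 : V) 1,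
        ENNReal.ofReal ((g (φ v)) ^ 2) ∂(Measure.hausdorffMeasure (k : ℝ)) := by
        gcongr
    _ = _ := by
        simp only [hφ, map_smul, smul_eq_mul, mul_pow, ENNReal.ofReal_mul (sq_nonneg M)]
        rw [lintegral_const_mul' _ _ ENNReal.ofReal_ne_top, ← mul_assoc,
          ← ENNReal.ofReal_mul (by positivity)]
        congr 2
        ring

theorem norm_symm_bounds {V W : Type*} [NormedAddCommGroup V] [NormedSpace ℝ V]
    [NormedAddCommGroup W] [NormedSpace ℝ W] {M : ℝ} (hM : 0 < M) (e : V ≃ₗ[ℝ] W)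
    (he : ∀ v : V, M⁻¹ * ‖v‖ ≤ ‖e v‖ ∧ ‖e v‖ ≤ M * ‖v‖) (w : W) :
    M⁻¹ * ‖w‖ ≤ ‖e.symm w‖ ∧ ‖e.symm w‖ ≤ M * ‖w‖ := by
  have h := he (e.symm w)
  rw [e.apply_symm_apply] at h
  exact ⟨(inv_mul_le_iff₀ hM).2 h.2, (inv_mul_le_iff₀ hM).1 h.1⟩

theorem cheegerDual_smul (W : Type*) [NormedAddCommGroup W] [NormedSpace ℝ W]
    [MeasurableSpace W] [BorelSpace W] (a : ℝ) (f : W →ₗ[ℝ] ℝ) :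
    cheegerDual W (a • f) = |a| * cheegerDual W f := by
  simp only [cheegerDual, LinearMap.smul_apply, smul_eq_mul, mul_pow,
    ENNReal.ofReal_mul (sq_nonneg a)]
  rw [lintegral_const_mul' _ _ ENNReal.ofReal_ne_top, ENNReal.toReal_mul,
    ENNReal.toReal_ofReal (sq_nonneg a), mul_left_comm, Real.sqrt_mul (sq_nonneg a),
    Real.sqrt_sq_eq_abs]

theorem cheegerDual_le {V W : Type*} [NormedAddCommGroup V] [NormedSpace ℝ V]
    [MeasurableSpace V] [BorelSpace V] [NormedAddCommGroup W] [NormedSpace ℝ W]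
    [MeasurableSpace W] [BorelSpace W] [FiniteDimensional ℝ V] {M : ℝ} (hM : 1 ≤ M)
    (e : V ≃ₗ[ℝ] W) (he : ∀ v : V, M⁻¹ * ‖v‖ ≤ ‖e v‖ ∧ ‖e v‖ ≤ M * ‖v‖) (g : W →ₗ[ℝ] ℝ) :
    cheegerDual W g ≤ M ^ (Module.finrank ℝ V + 1) * cheegerDual V (g ∘ₗ e.toLinearMap) := by
  have hM0 : 0 < M := by positivity
  have : FiniteDimensional ℝ W := e.finiteDimensional
  have h₁ := lintegral_ball_sq_le hM (Module.finrank ℝ V) e he g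
  have h₂ := lintegral_ball_sq_le hM (Module.finrank ℝ V) e.symm (norm_symm_bounds hM0 e he)
    (g ∘ₗ e.toLinearMap)
  simp only [LinearMap.comp_apply, LinearEquiv.coe_coe, e.apply_symm_apply] at h₂
  simp only [cheegerDual, ← e.finrank_eq, LinearMap.comp_apply, LinearEquiv.coe_coe]
  set k := Module.finrank ℝ V
  set A := ∫⁻ w in ball (0 : W) 1, ENNReal.ofReal ((g w) ^ 2)
    ∂(Measure.hausdorffMeasure (k : ℝ))
  set B := ∫⁻ v in ball (0 : V) 1, ENNReal.ofReal ((g (e v)) ^ 2)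
    ∂(Measure.hausdorffMeasure (k : ℝ))
  have hAB : A.toReal ≤ (M ^ (k + 1)) ^ 2 * B.toReal := by
    by_cases hA : A = ⊤
    · rw [hA, ENNReal.toReal_top]
      positivity
    · have hB : B ≠ ⊤ :=
        ne_top_of_le_ne_top (ENNReal.mul_ne_top ENNReal.ofReal_ne_top hA) h₂
      have := ENNReal.toReal_mono (ENNReal.mul_ne_top ENNReal.ofReal_ne_top hB) h₁
      rwa [ENNReal.toReal_mul, ENNReal.toReal_ofReal (by positivity)] at this
  have hc : 0 ≤ ((k : ℝ) + 1) * (eucBallVol k / eucBallVol (k + 2)) :=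
    mul_nonneg (by positivity) (div_nonneg ENNReal.toReal_nonneg ENNReal.toReal_nonneg)
  rw [← Real.sqrt_sq (by positivity : 0 ≤ M ^ (k + 1)), ← Real.sqrt_mul (sq_nonneg _),
    mul_left_comm]
  refine Real.sqrt_le_sqrt ?_
  exact mul_le_mul_of_nonneg_left hAB hc

theorem exists_cheegerDual_le_one {V W : Type*} [NormedAddCommGroup V] [NormedSpace ℝ V]
    [MeasurableSpace V] [BorelSpace V] [NormedAddCommGroup W] [NormedSpace ℝ W]
    [MeasurableSpace W] [BorelSpace W] [FiniteDimensional ℝ V] {M : ℝ} (hM : 1 ≤ M)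
    (e : V ≃ₗ[ℝ] W) (he : ∀ v : V, M⁻¹ * ‖v‖ ≤ ‖e v‖ ∧ ‖e v‖ ≤ M * ‖v‖)
    {f : V →ₗ[ℝ] ℝ} (hf : cheegerDual V f ≤ 1) :
    ∃ g : W →ₗ[ℝ] ℝ, cheegerDual W g ≤ 1 ∧
      ∀ v, f v = M ^ (Module.finrank ℝ V + 1) * g (e v) := by
  have hC : 0 < M ^ (Module.finrank ℝ V + 1) := by positivity
  refine ⟨(M ^ (Module.finrank ℝ V + 1))⁻¹ • (f ∘ₗ e.symm.toLinearMap), ?_, fun v => ?_⟩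
  · rw [cheegerDual_smul, abs_of_pos (inv_pos.2 hC), inv_mul_le_iff₀ hC]
    refine (cheegerDual_le hM e he _).trans (mul_le_mul_of_nonneg_left ?_ hC.le)
    have : (f ∘ₗ e.symm.toLinearMap) ∘ₗ e.toLinearMap = f := by ext; simp
    rwa [this]
  · simp [hC.ne']

theorem cheegerNorm_le {V W : Type*} [NormedAddCommGroup V] [NormedSpace ℝ V]
    [MeasurableSpace V] [BorelSpace V] [NormedAddCommGroup W] [NormedSpace ℝ W]
    [MeasurableSpace W] [BorelSpace W] [FiniteDimensional ℝ V] {M : ℝ} (hM : 1 ≤ M)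
    (e : V ≃ₗ[ℝ] W) (he : ∀ v : V, M⁻¹ * ‖v‖ ≤ ‖e v‖ ∧ ‖e v‖ ≤ M * ‖v‖) (v : V) :
    cheegerNorm V v ≤ M ^ (Module.finrank ℝ V + 1) * cheegerNorm W (e v) := by
  have hM0 : 0 < M := by positivity
  have : FiniteDimensional ℝ W := e.finiteDimensional
  have hzero : (0 : ℝ) ∈ {r : ℝ | ∃ g : W →ₗ[ℝ] ℝ, cheegerDual W g ≤ 1 ∧ r = g (e v)} :=
    ⟨0, by simp [cheegerDual], rfl⟩
  unfold cheegerNorm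
  by_cases hV : BddAbove {r : ℝ | ∃ f : V →ₗ[ℝ] ℝ, cheegerDual V f ≤ 1 ∧ r = f v}
  · have hW : BddAbove {r : ℝ | ∃ g : W →ₗ[ℝ] ℝ, cheegerDual W g ≤ 1 ∧ r = g (e v)} := by
      obtain ⟨b, hb⟩ := hV
      refine ⟨M ^ (Module.finrank ℝ W + 1) * b, ?_⟩
      rintro _ ⟨g, hg, rfl⟩
      obtain ⟨f, hf, hgf⟩ :=
        exists_cheegerDual_le_one hM e.symm (norm_symm_bounds hM0 e he) hg
      rw [hgf, e.symm_apply_apply]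
      exact mul_le_mul_of_nonneg_left (hb ⟨f, hf, rfl⟩) (by positivity)
    refine csSup_le ⟨0, 0, by simp [cheegerDual], rfl⟩ ?_
    rintro _ ⟨f, hf, rfl⟩
    obtain ⟨g, hg, hfg⟩ := exists_cheegerDual_le_one hM e he hf
    rw [hfg]
    exact mul_le_mul_of_nonneg_left (le_csSup hW ⟨g, hg, rfl⟩) (by positivity)
  · rw [Real.sSup_of_not_bddAbove hV]
    exact mul_nonneg (by positivity) (Real.sSup_nonneg' ⟨0, hzero, le_rfl⟩)

/-- for `M ≥ 1` and `k ∈ ℕ` there is a constant `C(M,k) ≥ 1` such that,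
whenever `‖·‖` and `‖·‖_o` are `M`-equivalent norms on a `k`-dimensional real vector space
(encoded by a linear equivalence `e : V ≃ₗ[ℝ] W` with `M⁻¹‖v‖ ≤ ‖e v‖ ≤ M‖v‖`), the
associated Cheeger inner-product norms satisfy
`C(M,k)⁻¹ |||v||| ≤ |||v|||_o ≤ C(M,k) |||v|||`. -/
theorem stmt12 (M : ℝ) (hM : 1 ≤ M) (k : ℕ) :
    ∃ C : ℝ, 1 ≤ C ∧
      ∀ (V W : Type) [NormedAddCommGroup V] [NormedSpace ℝ V]
        [MeasurableSpace V] [BorelSpace V]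
        [NormedAddCommGroup W] [NormedSpace ℝ W]
        [MeasurableSpace W] [BorelSpace W]
        [FiniteDimensional ℝ V],
        Module.finrank ℝ V = k →
        ∀ e : V ≃ₗ[ℝ] W,
          (∀ v : V, M⁻¹ * ‖v‖ ≤ ‖e v‖ ∧ ‖e v‖ ≤ M * ‖v‖) →
          ∀ v : V, C⁻¹ * cheegerNorm V v ≤ cheegerNorm W (e v) ∧
            cheegerNorm W (e v) ≤ C * cheegerNorm V v := by
  refine ⟨M ^ (k + 1), one_le_pow₀ hM, ?_⟩
  intro V W _ _ _ _ _ _ _ _ _ hk e he v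
  have hM0 : 0 < M := by positivity
  have : FiniteDimensional ℝ W := e.finiteDimensional
  have h₁ := cheegerNorm_le hM e he v
  have h₂ := cheegerNorm_le hM e.symm (norm_symm_bounds hM0 e he) (e v)
  rw [hk] at h₁
  rw [← e.finrank_eq, hk, e.symm_apply_apply] at h₂
  exact ⟨(inv_mul_le_iff₀ (by positivity)).2 h₁, h₂⟩

end
end

section
/- There exists a positive integer N such that for all x in K and all s in (0,1): if the words w, v in Λ(s) satisfy x ∈ K_w and K_v ∩ K(x,s) ≠ ∅, then max{|w| − N, 0} ≤ |v| ≤ |w| + N. -/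
open MeasureTheory Metric Filter Topology
open scoped NNReal ENNReal Matrix

noncomputable section

/-- The contraction `F_p(x) = (x + p)/2` of the plane towards `p`. -/
def Fc (p x : E2) : E2 := (2 : ℝ)⁻¹ • (x + p)

/-- `F_w = F_{w₁} ∘ ⋯ ∘ F_{wₙ}` for a word `w` in `{1,2,3}ⁿ`. -/
def Fw (p : Fin 3 → E2) : List (Fin 3) → E2 → E2
  | [] => id
  | i :: w => Fc (p i) ∘ Fw p w

/-- The three harmonic-structure matrices `T₁, T₂, T₃`. -/
def Tmat : Fin 3 → Matrix (Fin 2) (Fin 2) ℝ :=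
  ![!![3 / 5, 0; 0, 1 / 5],
    !![3 / 10, -(Real.sqrt 3 / 10); -(Real.sqrt 3 / 10), 1 / 2],
    !![3 / 10, Real.sqrt 3 / 10; Real.sqrt 3 / 10, 1 / 2]]

/-- `T_w = T_{w₁} ⋯ T_{wₙ}` for a word `w`. -/
def Tw (w : List (Fin 3)) : Matrix (Fin 2) (Fin 2) ℝ := (w.map Tmat).prod

/-- The Hilbert–Schmidt norm of a `2 × 2` real matrix. -/
def hsNorm (M : Matrix (Fin 2) (Fin 2) ℝ) : ℝ :=
  Real.sqrt (∑ i : Fin 2, ∑ j : Fin 2, (M i j) ^ 2)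

/-- The partition `Λ(s)`: words `w = w₁⋯wₙ` (with `n ≥ 1`) such that `‖T_w‖ ≤ s` and,
when `n ≥ 2`, also `s < ‖T_{w₁⋯w_{n−1}}‖`. -/
def Lam (s : ℝ) : Set (List (Fin 3)) :=
  {w | w ≠ [] ∧ hsNorm (Tw w) ≤ s ∧ (2 ≤ w.length → s < hsNorm (Tw w.dropLast))}

/-- The cell `K_w = F_w(K)`. -/
def Kcell (p : Fin 3 → E2) (K : Set E2) (w : List (Fin 3)) : Set E2 := Fw p w '' K

/-- `K(x,s) = ⋃ { K_w : w ∈ Λ(s), x ∈ K_w }`. -/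
def Kxs (p : Fin 3 → E2) (K : Set E2) (x : E2) (s : ℝ) : Set E2 :=
  ⋃ w ∈ {w | w ∈ Lam s ∧ x ∈ Kcell p K w}, Kcell p K w

/-- The squared Hilbert–Schmidt norm. -/
def hsSq (M : Matrix (Fin 2) (Fin 2) ℝ) : ℝ := ∑ i : Fin 2, ∑ j : Fin 2, (M i j) ^ 2

/-- The unit eigenvector of `Tmat j` for the eigenvalue `3/5`. -/
def slowVec : Fin 3 → Fin 2 → ℝ :=
  ![![1, 0], ![1 / 2, -(Real.sqrt 3 / 2)], ![1 / 2, Real.sqrt 3 / 2]]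

/-- The unit eigenvector of `Tmat j` for the eigenvalue `1/5`. -/
def fastVec : Fin 3 → Fin 2 → ℝ :=
  ![![0, 1], ![Real.sqrt 3 / 2, 1 / 2], ![-(Real.sqrt 3 / 2), 1 / 2]]

/-- The squared Euclidean length of `M e`. -/
def imgSq (M : Matrix (Fin 2) (Fin 2) ℝ) (e : Fin 2 → ℝ) : ℝ :=
  ∑ i : Fin 2, (M i 0 * e 0 + M i 1 * e 1) ^ 2

lemma hsSq_nonneg (M : Matrix (Fin 2) (Fin 2) ℝ) : 0 ≤ hsSq M :=
  Finset.sum_nonneg fun _ _ => Finset.sum_nonneg fun _ _ => sq_nonneg _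

lemma imgSq_nonneg (M : Matrix (Fin 2) (Fin 2) ℝ) (e : Fin 2 → ℝ) : 0 ≤ imgSq M e :=
  Finset.sum_nonneg fun _ _ => sq_nonneg _

lemma sqrt_three_sq : Real.sqrt 3 ^ 2 = 3 := Real.sq_sqrt (by norm_num)

lemma hsSq_eq_add (M : Matrix (Fin 2) (Fin 2) ℝ) (j : Fin 3) :
    hsSq M = imgSq M (slowVec j) + imgSq M (fastVec j) := by
  have h := sqrt_three_sq
  fin_cases j <;> simp [hsSq, imgSq, slowVec, fastVec, Fin.sum_univ_two]
  · ring
  · linear_combination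
      (-(M 0 0 ^ 2 + M 0 1 ^ 2 + M 1 0 ^ 2 + M 1 1 ^ 2) / 4) * h
  · linear_combination
      (-(M 0 0 ^ 2 + M 0 1 ^ 2 + M 1 0 ^ 2 + M 1 1 ^ 2) / 4) * h

lemma imgSq_smul (M : Matrix (Fin 2) (Fin 2) ℝ) (c : ℝ) (e : Fin 2 → ℝ) :
    imgSq M (c • e) = c ^ 2 * imgSq M e := by
  simp only [imgSq, Fin.sum_univ_two, Pi.smul_apply, smul_eq_mul]
  ring

lemma imgSq_mul (M T : Matrix (Fin 2) (Fin 2) ℝ) (e : Fin 2 → ℝ) :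
    imgSq (M * T) e = imgSq M (T *ᵥ e) := by
  simp only [imgSq, Fin.sum_univ_two, Matrix.mul_apply, Matrix.mulVec, dotProduct]
  ring

lemma Tmat_mulVec_slowVec (j : Fin 3) : Tmat j *ᵥ slowVec j = (3 / 5 : ℝ) • slowVec j := by
  have h := sqrt_three_sq
  ext i
  fin_cases j <;> fin_cases i <;>
    simp [Tmat, slowVec, Matrix.mulVec, dotProduct, Fin.sum_univ_two] <;>
    first | done | linear_combination (1 / 20) * h | ring

lemma Tmat_mulVec_fastVec (j : Fin 3) : Tmat j *ᵥ fastVec j = (1 / 5 : ℝ) • fastVec j := by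
  have h := sqrt_three_sq
  ext i
  fin_cases j <;> fin_cases i <;>
    simp [Tmat, fastVec, Matrix.mulVec, dotProduct, Fin.sum_univ_two] <;>
    first | done | ring1 | linear_combination (-1 / 20) * h

lemma imgSq_mul_slowVec (M : Matrix (Fin 2) (Fin 2) ℝ) (j : Fin 3) :
    imgSq (M * Tmat j) (slowVec j) = 9 / 25 * imgSq M (slowVec j) := by
  rw [imgSq_mul, Tmat_mulVec_slowVec, imgSq_smul]
  norm_num

lemma imgSq_mul_fastVec (M : Matrix (Fin 2) (Fin 2) ℝ) (j : Fin 3) :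
    imgSq (M * Tmat j) (fastVec j) = 1 / 25 * imgSq M (fastVec j) := by
  rw [imgSq_mul, Tmat_mulVec_fastVec, imgSq_smul]
  norm_num

/-- The matching condition at the common vertex of two neighbouring cells. -/
lemma imgSq_mul_slowVec_comm (M : Matrix (Fin 2) (Fin 2) ℝ) (i j : Fin 3) :
    imgSq (M * Tmat i) (slowVec j) = imgSq (M * Tmat j) (slowVec i) := by
  have h := sqrt_three_sq
  have key : Tmat i *ᵥ slowVec j = Tmat j *ᵥ slowVec i ∨
      Tmat i *ᵥ slowVec j = (-1 : ℝ) • (Tmat j *ᵥ slowVec i) := by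
    rcases eq_or_ne i j with rfl | hij
    · exact Or.inl rfl
    fin_cases i <;> fin_cases j <;> first
      | exact absurd rfl hij
      | (left; ext k; fin_cases k <;>
          simp [Tmat, slowVec, Matrix.mulVec, dotProduct, Fin.sum_univ_two] <;> ring1)
      | (right; ext k; fin_cases k <;>
          simp [Tmat, slowVec, Matrix.mulVec, dotProduct, Fin.sum_univ_two] <;>
          first | ring1 | linear_combination (-1 / 10) * h)
  rw [imgSq_mul, imgSq_mul]
  rcases key with h | h
  · rw [h]
  · rw [h, imgSq_smul]
    norm_num

lemma hsSq_mul_Tmat_le (M : Matrix (Fin 2) (Fin 2) ℝ) (j : Fin 3) :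
    hsSq (M * Tmat j) ≤ 9 / 25 * hsSq M := by
  rw [hsSq_eq_add (M * Tmat j) j, hsSq_eq_add M j, imgSq_mul_slowVec, imgSq_mul_fastVec]
  linarith [imgSq_nonneg M (fastVec j)]

lemma hsSq_le_mul_hsSq_mul_Tmat (M : Matrix (Fin 2) (Fin 2) ℝ) (j : Fin 3) :
    hsSq M ≤ 25 * hsSq (M * Tmat j) := by
  rw [hsSq_eq_add (M * Tmat j) j, hsSq_eq_add M j, imgSq_mul_slowVec, imgSq_mul_fastVec]
  linarith [imgSq_nonneg M (slowVec j)]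

lemma Tw_append (u v : List (Fin 3)) : Tw (u ++ v) = Tw u * Tw v := by
  simp [Tw]

lemma Tw_cons (i : Fin 3) (v : List (Fin 3)) : Tw (i :: v) = Tmat i * Tw v := by
  simp [Tw]

lemma hsSq_mul_Tw_le (z : List (Fin 3)) (M : Matrix (Fin 2) (Fin 2) ℝ) :
    hsSq (M * Tw z) ≤ (9 / 25) ^ z.length * hsSq M := by
  induction z generalizing M with
  | nil => simp [Tw]
  | cons i z ih =>
    rw [Tw_cons, ← mul_assoc, List.length_cons, pow_succ, mul_assoc ((9 / 25 : ℝ) ^ z.length)]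
    exact (ih (M * Tmat i)).trans
      (mul_le_mul_of_nonneg_left (hsSq_mul_Tmat_le M i) (by positivity))

lemma hsSq_Tw_append_le (u z : List (Fin 3)) : hsSq (Tw (u ++ z)) ≤ hsSq (Tw u) := by
  rw [Tw_append]
  exact (hsSq_mul_Tw_le z _).trans
    (mul_le_of_le_one_left (hsSq_nonneg _) (pow_le_one₀ (by norm_num) (by norm_num)))

lemma hsSq_mul_Tw_replicate (n : ℕ) (j : Fin 3) (M : Matrix (Fin 2) (Fin 2) ℝ) :
    hsSq (M * Tw (List.replicate n j)) =
      (9 / 25) ^ n * imgSq M (slowVec j) + (1 / 25) ^ n * imgSq M (fastVec j) := by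
  induction n generalizing M with
  | zero => simp [Tw, ← hsSq_eq_add]
  | succ n ih =>
    rw [List.replicate_succ, Tw_cons, ← mul_assoc, ih, imgSq_mul_slowVec, imgSq_mul_fastVec]
    ring

/-- Two cells of the same level that touch at a vertex have comparable norms. -/
lemma hsSq_mul_Tw_cons_replicate_le (M : Matrix (Fin 2) (Fin 2) ℝ) (i j : Fin 3) (n : ℕ) :
    hsSq (M * Tw (i :: List.replicate n j)) ≤ 10 * hsSq (M * Tw (j :: List.replicate n i)) := by
  rw [Tw_cons, Tw_cons, ← mul_assoc, ← mul_assoc, hsSq_mul_Tw_replicate, hsSq_mul_Tw_replicate,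
    imgSq_mul_slowVec_comm M i j]
  have h1 : imgSq (M * Tmat i) (fastVec j) ≤
      9 * (imgSq (M * Tmat j) (slowVec i) + imgSq (M * Tmat j) (fastVec i)) := by
    linarith [hsSq_eq_add (M * Tmat i) j, hsSq_eq_add (M * Tmat j) i, hsSq_mul_Tmat_le M i,
      hsSq_le_mul_hsSq_mul_Tmat M j, imgSq_nonneg (M * Tmat i) (slowVec j)]
  have h2 : (1 / 25 : ℝ) ^ n ≤ (9 / 25) ^ n := pow_le_pow_left₀ (by norm_num) (by norm_num) n
  have h3 : (0 : ℝ) ≤ (1 / 25) ^ n := by positivity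
  have h4 := mul_le_mul_of_nonneg_left h1 h3
  have h5 := mul_le_mul_of_nonneg_right h2 (imgSq_nonneg (M * Tmat j) (slowVec i))
  have h6 := mul_nonneg h3 (imgSq_nonneg (M * Tmat j) (fastVec i))
  linarith

lemma hsSq_le_of_mem_Lam {s : ℝ} {w : List (Fin 3)} (hw : w ∈ Lam s) :
    hsSq (Tw w) ≤ s ^ 2 :=
  (Real.sqrt_le_left ((Real.sqrt_nonneg _).trans hw.2.1)).1 hw.2.1

lemma lt_hsSq_dropLast_of_mem_Lam {s : ℝ} (hs : 0 ≤ s) {w : List (Fin 3)} (hw : w ∈ Lam s)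
    (hl : 2 ≤ w.length) : s ^ 2 < hsSq (Tw w.dropLast) :=
  (Real.lt_sqrt hs).1 (hw.2.2 hl)

lemma eq_of_mem_Lam_of_prefix {s : ℝ} (hs : 0 ≤ s) {w v : List (Fin 3)} (hw : w ∈ Lam s)
    (hv : v ∈ Lam s) (h : w <+: v) : w = v := by
  obtain ⟨z, rfl⟩ := h
  rcases eq_or_ne z [] with rfl | hz
  · simp
  exfalso
  have h1 := List.length_pos_iff.2 hw.1
  have h2 := List.length_pos_iff.2 hz
  have h3 := lt_hsSq_dropLast_of_mem_Lam hs hv (by rw [List.length_append]; omega)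
  rw [List.dropLast_append_of_ne_nil hz] at h3
  linarith [hsSq_le_of_mem_Lam hw, hsSq_Tw_append_le w z.dropLast]

lemma le_add_three_of_mem_Lam {s : ℝ} (hs : 0 ≤ s) {u : List (Fin 3)} {i j : Fin 3} {n m : ℕ}
    (hw : u ++ i :: List.replicate n j ∈ Lam s) (hv : u ++ j :: List.replicate m i ∈ Lam s) :
    m ≤ n + 3 := by
  by_contra! h
  obtain ⟨k, rfl⟩ : ∃ k, m = n + (3 + k) + 1 := ⟨m - n - 4, by omega⟩
  have h1 := lt_hsSq_dropLast_of_mem_Lam hs hv (by simp; omega)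
  rw [List.replicate_succ', List.dropLast_append_of_ne_nil (by simp), ← List.cons_append,
    List.dropLast_concat, Tw_append] at h1
  have h2 := hsSq_mul_Tw_cons_replicate_le (Tw u) j i (n + (3 + k))
  have h3 : Tw u * Tw (i :: List.replicate (n + (3 + k)) j) =
      Tw (u ++ i :: List.replicate n j) * Tw (List.replicate (3 + k) j) := by
    rw [← Tw_append, ← Tw_append, List.append_assoc, List.cons_append,
      List.replicate_append_replicate]
  have h4 := hsSq_mul_Tw_le (List.replicate (3 + k) j) (Tw (u ++ i :: List.replicate n j))
  rw [h3] at h2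
  rw [List.length_replicate, pow_add] at h4
  have h5 : (9 / 25 : ℝ) ^ k ≤ 1 := pow_le_one₀ (by norm_num) (by norm_num)
  have h6 := hsSq_nonneg (Tw (u ++ i :: List.replicate n j))
  have h7 := mul_le_mul_of_nonneg_right h5 h6
  linarith [hsSq_le_of_mem_Lam hw]

lemma List.prefix_or_prefix_or_exists_append_cons {α : Type*} (w v : List α) :
    w <+: v ∨ v <+: w ∨
      ∃ u i j w' v', i ≠ j ∧ w = u ++ i :: w' ∧ v = u ++ j :: v' := by
  induction w generalizing v with
  | nil => simp
  | cons a w ih =>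
    cases v with
    | nil => simp
    | cons b v =>
      rcases eq_or_ne a b with rfl | hab
      · rcases ih v with h | h | ⟨u, i, j, w', v', hij, rfl, rfl⟩
        · exact Or.inl (by simpa using h)
        · exact Or.inr (Or.inl (by simpa using h))
        · exact Or.inr (Or.inr ⟨a :: u, i, j, w', v', hij, rfl, rfl⟩)
      · exact Or.inr (Or.inr ⟨[], a, b, w, v, hab, rfl, rfl⟩)

/-- Barycentric coordinates of an equilateral triangle. -/
lemma exists_barycentric (p : Fin 3 → E2)
    (hequi : dist (p 0) (p 1) = dist (p 1) (p 2) ∧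
      dist (p 0) (p 1) = dist (p 0) (p 2) ∧ 0 < dist (p 0) (p 1)) :
    ∃ L : Fin 3 → E2 → ℝ, (∀ k, Continuous (L k)) ∧ (∀ x, L 0 x + L 1 x + L 2 x = 1) ∧
      ∀ k i x, L k (Fc (p i) x) = (L k x + if i = k then 1 else 0) / 2 := by
  obtain ⟨h1, h2, h3⟩ := hequi
  have hsq : ∀ a b : E2, dist a b ^ 2 = (a 0 - b 0) ^ 2 + (a 1 - b 1) ^ 2 := fun a b => by
    rw [EuclideanSpace.dist_eq, Real.sq_sqrt (by positivity)]
    simp [Fin.sum_univ_two, Real.dist_eq, sq_abs]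
  have e1 : dist (p 0) (p 1) ^ 2 = dist (p 1) (p 2) ^ 2 := by rw [h1]
  have e2 : dist (p 0) (p 1) ^ 2 = dist (p 0) (p 2) ^ 2 := by rw [h2]
  have e3 : 0 < dist (p 0) (p 1) ^ 2 := by positivity
  rw [hsq, hsq] at e1 e2
  rw [hsq] at e3
  generalize hD : (p 0 0 - p 1 0) ^ 2 + (p 0 1 - p 1 1) ^ 2 = D at e1 e2 e3
  have hD0 : D ≠ 0 := e3.ne'
  let g : Fin 2 → ℝ := fun a => (p 0 a + p 1 a + p 2 a) / 3
  refine ⟨fun k x => 1 / 3 + 2 / D * ((x 0 - g 0) * (p k 0 - g 0) + (x 1 - g 1) * (p k 1 - g 1)),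
    fun k => by fun_prop, fun x => ?_, fun k i x => ?_⟩
  · simp only [g]
    ring
  · have key : 1 / 3 + 2 / D * ((p i 0 - g 0) * (p k 0 - g 0) + (p i 1 - g 1) * (p k 1 - g 1)) =
        if i = k then 1 else 0 := by
      field_simp
      fin_cases i <;> fin_cases k <;> simp [g] <;> linarith
    rw [← key]
    simp only [Fc, PiLp.smul_apply, PiLp.add_apply, smul_eq_mul]
    ring

lemma Fc_injective (q : E2) : Function.Injective (Fc q) := fun x y h => by
  simpa [Fc] using h

lemma Fw_injective (p : Fin 3 → E2) (w : List (Fin 3)) : Function.Injective (Fw p w) := by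
  induction w with
  | nil => exact Function.injective_id
  | cons i w ih => exact (Fc_injective _).comp ih

lemma Fw_append (p : Fin 3 → E2) (u w : List (Fin 3)) (x : E2) :
    Fw p (u ++ w) x = Fw p u (Fw p w x) := by
  induction u with
  | nil => rfl
  | cons i u ih => exact congrArg (Fc (p i)) ih

lemma Fw_mem {p : Fin 3 → E2} {K : Set E2} (hK : ∀ i, ∀ x ∈ K, Fc (p i) x ∈ K)
    (w : List (Fin 3)) {x : E2} (hx : x ∈ K) : Fw p w x ∈ K := by
  induction w with
  | nil => exact hx
  | cons i w ih => exact hK i _ ih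

lemma barycentric_nonneg {p : Fin 3 → E2} {K : Set E2} (hKc : IsCompact K)
    (hK : ∀ x ∈ K, ∃ i, ∃ y ∈ K, Fc (p i) y = x) {f : E2 → ℝ} (hf : Continuous f)
    (k : Fin 3) (hL : ∀ i x, f (Fc (p i) x) = (f x + if i = k then 1 else 0) / 2)
    {x : E2} (hx : x ∈ K) : 0 ≤ f x := by
  obtain ⟨z, hz, hmin⟩ := hKc.exists_isMinOn ⟨x, hx⟩ hf.continuousOn
  obtain ⟨i, y, hy, rfl⟩ := hK z hz
  have h1 := hmin hy
  have h2 := hmin hx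
  simp only [Set.mem_ofPred_eq] at h1 h2
  rw [hL] at h1 h2
  split_ifs at h1 h2 <;> linarith

/-- A cell containing the vertex `p k` has address `k ⋯ k`. -/
lemma eq_replicate_of_barycentric_eq_one {p : Fin 3 → E2} {K : Set E2}
    (hK : ∀ i, ∀ x ∈ K, Fc (p i) x ∈ K) {f : E2 → ℝ} (k : Fin 3)
    (hL : ∀ i x, f (Fc (p i) x) = (f x + if i = k then 1 else 0) / 2)
    (hf : ∀ x ∈ K, f x ≤ 1) (w : List (Fin 3)) {x : E2} (hx : x ∈ K) (h : f (Fw p w x) = 1) :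
    w = List.replicate w.length k := by
  induction w with
  | nil => rfl
  | cons i w ih =>
    have h1 := hf _ (Fw_mem hK w hx)
    change f (Fc (p i) (Fw p w x)) = 1 at h
    rw [hL] at h
    split_ifs at h with hik
    · rw [List.length_cons, List.replicate_succ, ← ih (by linarith), hik]
    · linarith

/-- Two distinct intersecting cells that branch after `u` touch at a vertex. -/
lemma eq_replicate_of_Fw_eq {p : Fin 3 → E2} {K : Set E2} {L : Fin 3 → E2 → ℝ}
    (hK : ∀ i, ∀ x ∈ K, Fc (p i) x ∈ K) (hL0 : ∀ k, ∀ x ∈ K, 0 ≤ L k x)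
    (hsum : ∀ x, L 0 x + L 1 x + L 2 x = 1)
    (hL : ∀ k i x, L k (Fc (p i) x) = (L k x + if i = k then 1 else 0) / 2)
    {i j : Fin 3} (hij : i ≠ j) {w v : List (Fin 3)} {x y : E2} (hx : x ∈ K) (hy : y ∈ K)
    (h : Fc (p i) (Fw p w x) = Fc (p j) (Fw p v y)) : w = List.replicate w.length j := by
  have hadd : ∀ z ∈ K, ∀ a b : Fin 3, a ≠ b → L a z + L b z ≤ 1 := fun z hz a b hab => by
    have h0 := hL0 0 z hz
    have h1 := hL0 1 z hz
    have h2 := hL0 2 z hz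
    have h3 := hsum z
    fin_cases a <;> fin_cases b <;> first | exact absurd rfl hab | (simp; linarith)
  have hle : ∀ z ∈ K, L j z ≤ 1 := fun z hz => by linarith [hadd z hz i j hij, hL0 i z hz]
  have hwx := Fw_mem hK w hx
  have hvy := Fw_mem hK v hy
  refine eq_replicate_of_barycentric_eq_one hK j (hL j) hle w hx ?_
  have h1 := hL j i (Fw p w x)
  rw [h, hL, if_pos rfl, if_neg hij] at h1
  linarith [hle _ hwx, hL0 j _ hvy]

lemma length_le_add_three {p : Fin 3 → E2} {K : Set E2} {L : Fin 3 → E2 → ℝ}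
    (hK : ∀ i, ∀ x ∈ K, Fc (p i) x ∈ K) (hL0 : ∀ k, ∀ x ∈ K, 0 ≤ L k x)
    (hsum : ∀ x, L 0 x + L 1 x + L 2 x = 1)
    (hL : ∀ k i x, L k (Fc (p i) x) = (L k x + if i = k then 1 else 0) / 2)
    {s : ℝ} (hs : 0 ≤ s) {w v : List (Fin 3)} (hw : w ∈ Lam s) (hv : v ∈ Lam s)
    {z : E2} (hzw : z ∈ Kcell p K w) (hzv : z ∈ Kcell p K v) : v.length ≤ w.length + 3 := by
  rcases List.prefix_or_prefix_or_exists_append_cons w v with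
    h | h | ⟨u, i, j, w', v', hij, rfl, rfl⟩
  · rw [eq_of_mem_Lam_of_prefix hs hw hv h]
    omega
  · rw [eq_of_mem_Lam_of_prefix hs hv hw h]
    omega
  · obtain ⟨x, hx, rfl⟩ := hzw
    obtain ⟨y, hy, hxy⟩ := hzv
    rw [Fw_append, Fw_append] at hxy
    have h := Fw_injective p u hxy
    have h1 := eq_replicate_of_Fw_eq hK hL0 hsum hL hij hx hy h.symm
    have h2 := eq_replicate_of_Fw_eq hK hL0 hsum hL hij.symm hy hx h
    rw [h1] at hw
    rw [h2] at hv
    have := le_add_three_of_mem_Lam hs hw hv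
    simp only [List.length_append, List.length_cons]
    omega

/-- there is a positive integer `N` such that for every `x ∈ K` and
`s ∈ (0,1)`, if `w, v ∈ Λ(s)` satisfy `x ∈ K_w` and `K_v ∩ K(x,s) ≠ ∅`, then
`max{|w| − N, 0} ≤ |v| ≤ |w| + N`. -/
theorem stmt19 (p : Fin 3 → E2)
    (hequi : dist (p 0) (p 1) = dist (p 1) (p 2) ∧
      dist (p 0) (p 1) = dist (p 0) (p 2) ∧ 0 < dist (p 0) (p 1))
    (K : Set E2) (hKc : IsCompact K) (hKne : K.Nonempty)
    (hKself : K = (Fc (p 0) '' K) ∪ (Fc (p 1) '' K) ∪ (Fc (p 2) '' K)) :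
    ∃ N : ℕ, 0 < N ∧ ∀ x ∈ K, ∀ s ∈ Set.Ioo (0 : ℝ) 1, ∀ w ∈ Lam s, ∀ v ∈ Lam s,
      x ∈ Kcell p K w → (Kcell p K v ∩ Kxs p K x s).Nonempty →
        w.length - N ≤ v.length ∧ v.length ≤ w.length + N := by
  have hK : ∀ i, ∀ x ∈ K, Fc (p i) x ∈ K := fun i x hx => by
    rw [hKself]
    fin_cases i
    · exact Or.inl (Or.inl ⟨x, hx, rfl⟩)
    · exact Or.inl (Or.inr ⟨x, hx, rfl⟩)
    · exact Or.inr ⟨x, hx, rfl⟩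
  have hK' : ∀ x ∈ K, ∃ i, ∃ y ∈ K, Fc (p i) y = x := fun x hx => by
    rw [hKself] at hx
    rcases hx with (h | h) | h
    · exact ⟨0, h⟩
    · exact ⟨1, h⟩
    · exact ⟨2, h⟩
  obtain ⟨L, hcont, hsum, hL⟩ := exists_barycentric p hequi
  have hL0 : ∀ k, ∀ x ∈ K, 0 ≤ L k x := fun k x hx =>
    barycentric_nonneg hKc hK' (hcont k) k (hL k) hx
  refine ⟨6, by norm_num, fun x _ s hs w hw v hv hxw hne => ?_⟩
  obtain ⟨z, hzv, hz⟩ := hne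
  simp only [Kxs, Set.mem_iUnion, Set.mem_ofPred_eq] at hz
  obtain ⟨a, ⟨ha, hxa⟩, hza⟩ := hz
  have hs0 : 0 ≤ s := hs.1.le
  have h1 := length_le_add_three hK hL0 hsum hL hs0 hw ha hxw hxa
  have h2 := length_le_add_three hK hL0 hsum hL hs0 ha hw hxa hxw
  have h3 := length_le_add_three hK hL0 hsum hL hs0 ha hv hza hzv
  have h4 := length_le_add_three hK hL0 hsum hL hs0 hv ha hzv hza
  omega

end
end
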